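/- arXiv:2411.06883 — 2 statements merged into one kernel-verified Lean document; each statement's English description precedes it below -/
import Mathlib

section
/- For any parameters k_P > 0 and k_I > 0, there exists a least-squares solution x* of Ax = b such that the solution (x̂(t), ω̂(t), ẑ(t)) of the linear ODE x̂' = −Âᵀ(Âx̂ − b̂ − L̂_c^{1/2}ω̂) − k_P L̂ x̂ − k_I ẑ, ω̂' = L̂_c^{1/2}(Âx̂ − b̂ − L̂_c^{1/2}ω̂), ẑ' = L̂ x̂, with initial conditions x̂(0) = 0, ω̂(0) = 0, ẑ(0) = 0, converges exponentially to x̂*: there exist constants C > 0 and c > 0 such that ‖x̂(t) − x̂*‖ ≤ C e^{−c t} for all t ≥ 0. -/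
open Matrix

section Setup

variable {p q : ℕ} {mdim : Fin p → ℕ} {ndim : Fin q → ℕ}

/-- Index set for the stacked vector `x̂ ∈ ℝ^{pn}`: component `⟨j, (i, c)⟩` is the `c`-th entry
of agent `i`'s guess of the `j`-th portion of the solution. -/
abbrev ColIx (p q : ℕ) (ndim : Fin q → ℕ) : Type := Σ j : Fin q, Fin p × Fin (ndim j)

/-- Index set for the stacked vector `b̂ ∈ ℝ^{qm}`: component `(j, ⟨i, r⟩)` is the `r`-th entry
of `b_{ij}`. -/
abbrev RowIx (p q : ℕ) (mdim : Fin p → ℕ) : Type := Fin q × Σ i : Fin p, Fin (mdim i)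

/-- The block-diagonal matrix `Â = blockdiag(Â₁, …, Â_q)`, `Â_j = blockdiag(A_{1j}, …, A_{pj})`. -/
def Ahat (A : Matrix (Σ i : Fin p, Fin (mdim i)) (Σ j : Fin q, Fin (ndim j)) ℝ) :
    Matrix (RowIx p q mdim) (ColIx p q ndim) ℝ :=
  fun r c => if r.1 = c.1 ∧ r.2.1 = c.2.1 then A r.2 ⟨c.1, c.2.2⟩ else 0

/-- The block-diagonal matrix `L̂ = blockdiag(L ⊗ I_{n₁}, …, L ⊗ I_{n_q})`. -/
def Lhat (L : Matrix (Fin p) (Fin p) ℝ) :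
    Matrix (ColIx p q ndim) (ColIx p q ndim) ℝ :=
  fun r c =>
    if (⟨r.1, r.2.2⟩ : Σ j : Fin q, Fin (ndim j)) = ⟨c.1, c.2.2⟩ then L r.2.1 c.2.1 else 0

/-- The Kronecker product `L̂_c = L_c ⊗ I_m`. -/
def Lchat (Lc : Matrix (Fin q) (Fin q) ℝ) :
    Matrix (RowIx p q mdim) (RowIx p q mdim) ℝ :=
  fun r c => if r.2 = c.2 then Lc r.1 c.1 else 0

/-- The stacked observation vector `b̂ ∈ ℝ^{qm}` built from the pieces `b_{ij}`. -/
def bhat (bblk : (i : Fin p) → Fin q → Fin (mdim i) → ℝ) : RowIx p q mdim → ℝ :=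
  fun r => bblk r.2.1 r.1 r.2.2

/-- The observation vector `b ∈ ℝ^m`, with `b_i = Σ_j b_{ij}`. -/
def bvec (bblk : (i : Fin p) → Fin q → Fin (mdim i) → ℝ) : (Σ i : Fin p, Fin (mdim i)) → ℝ :=
  fun a => ∑ j : Fin q, bblk a.1 j a.2

/-- `x` is a least-squares solution of `A x = b` (minimizer of the Euclidean residual). -/
def IsLSSol {ι κ : Type*} [Fintype ι] [Fintype κ] (A : Matrix ι κ ℝ) (b : ι → ℝ)
    (x : κ → ℝ) : Prop :=
  ∀ y : κ → ℝ, (A.mulVec x - b) ⬝ᵥ (A.mulVec x - b) ≤ (A.mulVec y - b) ⬝ᵥ (A.mulVec y - b)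

/-- The consensus vector `x̂* ∈ ℝ^{pn}` obtained by stacking `p` copies of each portion of
`x* ∈ ℝⁿ`. -/
def stackVec (xstar : (Σ j : Fin q, Fin (ndim j)) → ℝ) : ColIx p q ndim → ℝ :=
  fun c => xstar ⟨c.1, c.2.2⟩

end Setup

section aux

open scoped InnerProductSpace

theorem aux_decay (Q Q' : ℝ → ℝ) (c : ℝ) (hQ : ∀ t, HasDerivAt Q (Q' t) t)
    (h : ∀ t, Q' t ≤ -c * Q t) : ∀ t ≥ (0:ℝ), Q t ≤ Q 0 * Real.exp (-c * t) := by
  intro t ht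
  have hd : ∀ t, HasDerivAt (fun t => Real.exp (c * t) * Q t)
      (Real.exp (c * t) * (c * 1) * Q t + Real.exp (c * t) * Q' t) t := fun t =>
    (((hasDerivAt_id t).const_mul c).exp).mul (hQ t)
  have ha : Antitone (fun t => Real.exp (c * t) * Q t) := by
    apply antitone_of_hasDerivAt_nonpos hd
    intro s
    have := Real.exp_pos (c * s)
    have h2 := h s
    show Real.exp (c * s) * (c * 1) * Q s + Real.exp (c * s) * Q' s ≤ 0
    nlinarith [mul_le_mul_of_nonneg_left h2 this.le]
  have h1 := ha ht
  simp only [mul_zero, Real.exp_zero, one_mul] at h1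
  have : Q t = Real.exp (-c * t) * (Real.exp (c * t) * Q t) := by
    rw [← mul_assoc, ← Real.exp_add]; simp
  rw [this, mul_comm (Q 0)]
  exact mul_le_mul_of_nonneg_left h1 (Real.exp_pos _).le

set_option maxHeartbeats 2000000 in
theorem aux_abs {E1 E2 E3 : Type*} [NormedAddCommGroup E1] [InnerProductSpace ℝ E1]
    [FiniteDimensional ℝ E1] [NormedAddCommGroup E2] [InnerProductSpace ℝ E2]
    [FiniteDimensional ℝ E2] [NormedAddCommGroup E3] [InnerProductSpace ℝ E3]
    [FiniteDimensional ℝ E3]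
    (A : E1 →L[ℝ] E2) (At : E2 →L[ℝ] E1) (hA : ∀ x y, ⟪At y, x⟫_ℝ = ⟪y, A x⟫_ℝ)
    (M : E2 →L[ℝ] E2) (hM : ∀ x y, ⟪M y, x⟫_ℝ = ⟪y, M x⟫_ℝ)
    (S : E1 →L[ℝ] E3) (St : E3 →L[ℝ] E1) (hS : ∀ x y, ⟪St y, x⟫_ℝ = ⟪y, S x⟫_ℝ)
    (k : ℝ) (hk : 0 < k) (b : E2) (x : ℝ → E1) (w : ℝ → E2) (u : ℝ → E3)
    (hx : ∀ t, HasDerivAt x (-At (A (x t) - b - M (w t)) - k • St (S (x t)) - St (u t)) t)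
    (hw : ∀ t, HasDerivAt w (M (A (x t) - b - M (w t))) t)
    (hu : ∀ t, HasDerivAt u (S (x t)) t) :
    ∃ xs ws us, S xs = 0 ∧ M (A xs - b - M ws) = 0 ∧ At (A xs - b - M ws) + St us = 0 ∧
      ∃ C > (0:ℝ), ∃ c > (0:ℝ), ∀ t ≥ (0:ℝ), ‖x t - xs‖ ≤ C * Real.exp (-c * t) := by
  let R : (E1 × E2 × E3) →L[ℝ] E2 :=
    A.comp (ContinuousLinearMap.fst ℝ E1 (E2 × E3)) -
      M.comp ((ContinuousLinearMap.fst ℝ E2 E3).comp (ContinuousLinearMap.snd ℝ E1 (E2 × E3)))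
  let SX : (E1 × E2 × E3) →L[ℝ] E3 := S.comp (ContinuousLinearMap.fst ℝ E1 (E2 × E3))
  let SU : (E1 × E2 × E3) →L[ℝ] E1 :=
    St.comp ((ContinuousLinearMap.snd ℝ E2 E3).comp (ContinuousLinearMap.snd ℝ E1 (E2 × E3)))
  let F : (E1 × E2 × E3) →L[ℝ] (E1 × E2 × E3) :=
    (-(At.comp R) - k • (St.comp SX) - SU).prod ((M.comp R).prod SX)
  let H : (E1 × E2 × E3) →L[ℝ] (E2 × E3 × E1) := R.prod (SX.prod SU)
  have hR : ∀ e, R e = A e.1 - M e.2.1 := fun e => rfl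
  have hF : ∀ e, F e = (-(At (A e.1 - M e.2.1)) - k • St (S e.1) - St e.2.2,
    M (A e.1 - M e.2.1), S e.1) := fun e => rfl
  have hH : ∀ e, H e = (A e.1 - M e.2.1, S e.1, St e.2.2) := fun e => rfl
  have hker : ∀ e, F e = 0 → A e.1 - M e.2.1 = 0 ∧ S e.1 = 0 ∧ St e.2.2 = 0 := by
    intro e he
    rw [hF] at he
    simp only [Prod.mk_eq_zero] at he
    obtain ⟨h1, h2, h3⟩ := he
    have h4 : ⟪-(At (A e.1 - M e.2.1)) - k • St (S e.1) - St e.2.2, e.1⟫_ℝ = 0 := by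
      rw [h1]; simp
    have h5 : ⟪M (A e.1 - M e.2.1), e.2.1⟫_ℝ = 0 := by rw [h2]; simp
    rw [h3] at h4
    simp only [inner_sub_left, inner_neg_left, hA, hS, h3, inner_zero_right, map_zero,
      smul_zero, inner_zero_left] at h4
    rw [hM] at h5
    have h6 : A e.1 - M e.2.1 = 0 := by
      rw [← inner_self_eq_zero (𝕜 := ℝ)]
      rw [inner_sub_right]
      simp only [inner_sub_left] at h4 h5 ⊢
      linarith
    refine ⟨h6, h3, ?_⟩
    rw [h6, h3] at h1
    simpa using h1
  -- orthogonality of kernel and range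
  have horth : ∀ e v, F v = 0 → ⟪(F e).1, v.1⟫_ℝ + ⟪(F e).2.1, v.2.1⟫_ℝ + ⟪(F e).2.2, v.2.2⟫_ℝ = 0 := by
    intro e v hv
    obtain ⟨h1, h2, h3⟩ := hker v hv
    rw [hF]
    simp only [inner_sub_left, inner_neg_left, inner_smul_left, hA, hS, hM, h2, inner_zero_right]
    have h4 : ⟪S e.1, v.2.2⟫_ℝ = 0 := by
      rw [real_inner_comm, ← hS, h3, inner_zero_left]
    have h5 : A v.1 = M v.2.1 := sub_eq_zero.1 h1
    rw [h4, h5]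
    simp
  have hself : ∀ v : E1 × E2 × E3, ⟪v.1, v.1⟫_ℝ + ⟪v.2.1, v.2.1⟫_ℝ + ⟪v.2.2, v.2.2⟫_ℝ = 0 → v = 0 := by
    intro v hv
    have h1 := real_inner_self_nonneg (x := v.1)
    have h2 := real_inner_self_nonneg (x := v.2.1)
    have h3 := real_inner_self_nonneg (x := v.2.2)
    have e1 : v.1 = 0 := (inner_self_eq_zero (𝕜 := ℝ)).1 (by linarith)
    have e2 : v.2.1 = 0 := (inner_self_eq_zero (𝕜 := ℝ)).1 (by linarith)
    have e3 : v.2.2 = 0 := (inner_self_eq_zero (𝕜 := ℝ)).1 (by linarith)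
    exact Prod.ext e1 (Prod.ext e2 e3)
  let Fl : (E1 × E2 × E3) →ₗ[ℝ] (E1 × E2 × E3) := F.toLinearMap
  have hdisj : Disjoint Fl.ker Fl.range := by
    rw [Submodule.disjoint_def]
    rintro v hv ⟨e, rfl⟩
    exact hself _ (horth e _ hv)
  have hcompl : IsCompl Fl.ker Fl.range := by
    refine ⟨hdisj, ?_⟩
    rw [codisjoint_iff]
    apply Submodule.eq_top_of_disjoint _ _ _ hdisj
    rw [add_comm, LinearMap.finrank_range_add_finrank_ker]
  -- projection
  let P : (E1 × E2 × E3) →ₗ[ℝ] (E1 × E2 × E3) := Submodule.projection _ _ hcompl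
  have hPker : ∀ e, F (P e) = 0 := fun e => Submodule.projection_apply_mem hcompl e
  have hPF : ∀ e, P (F e) = 0 := fun e =>
    (Submodule.projection_apply_eq_zero_iff hcompl).2 ⟨e, rfl⟩
  have hPP : ∀ e, F e = 0 → P e = e := fun e he =>
    Submodule.projection_apply_of_mem_left hcompl he
  have hPsub : ∀ e, ∃ v, F v = e - P e := by
    intro e
    have h : P (e - P e) = 0 := by
      rw [map_sub, hPP (P e) (hPker e), sub_self]
    exact (Submodule.projection_apply_eq_zero_iff hcompl).1 h
  -- equilibrium
  obtain ⟨q0, hq0⟩ : ∃ q0, F q0 = (-(At b), M b, 0) := by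
    obtain ⟨v, hv⟩ := hPsub (-(At b), M b, 0)
    refine ⟨v, ?_⟩
    rw [hv]
    set g : E1 × E2 × E3 := (-(At b), M b, 0) with hg
    have : P g = 0 := by
      apply hself
      have h1 := horth v (P g) (hPker g)
      obtain ⟨h2, h3, h4⟩ := hker _ (hPker g)
      rw [hv] at h1
      simp only [hg, Prod.fst_sub, Prod.snd_sub, inner_sub_left, inner_neg_left, hA, hM,
        inner_zero_left] at h1
      rw [← hg, sub_eq_zero.1 h2] at h1
      linarith
    rw [this, sub_zero]
  let e : ℝ → E1 × E2 × E3 := fun t => (x t, w t, u t) - q0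
  have he : ∀ t, HasDerivAt e (F (e t)) t := by
    intro t
    have h1 := ((hx t).prodMk ((hw t).prodMk (hu t))).sub_const q0
    refine h1.congr_deriv (Eq.symm ?_)
    show F ((x t, w t, u t) - q0) = _
    rw [map_sub, hq0, hF]
    simp only [Prod.mk_sub_mk, map_sub]
    refine Prod.ext ?_ (Prod.ext ?_ ?_)
    · simp; abel
    · simp; abel
    · simp
  -- P e constant
  have hPe : ∀ t, P (e t) = P (e 0) := by
    intro t
    have h1 : ∀ t, HasDerivAt (fun t => P (e t)) 0 t := by
      intro t
      have := (LinearMap.toContinuousLinearMap P).hasFDerivAt.comp_hasDerivAt t (he t)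
      have h2 : (LinearMap.toContinuousLinearMap P) (F (e t)) = 0 := hPF _
      rw [h2] at this
      exact this
    exact is_const_of_deriv_eq_zero (fun t => (h1 t).differentiableAt) (fun t => (h1 t).deriv) t 0
  obtain ⟨qs, hqs⟩ : ∃ qs, qs = q0 + P (e 0) := ⟨_, rfl⟩
  have hFqs : F qs = (-(At b), M b, 0) := by rw [hqs, map_add, hPker, hq0, add_zero]
  let d : ℝ → E1 × E2 × E3 := fun t => (x t, w t, u t) - qs
  have hde : ∀ t, d t = e t - P (e t) := by
    intro t
    show (x t, w t, u t) - qs = (x t, w t, u t) - q0 - _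
    rw [hPe, hqs]; abel
  have hd : ∀ t, HasDerivAt d (F (d t)) t := by
    intro t
    have : d = fun t => e t - P (e 0) := by
      funext s; rw [hde, hPe]
    rw [hde, map_sub, hPker, sub_zero, this]
    exact (he t).sub_const _
  -- coercivity
  obtain ⟨K, hK, hKb⟩ : ∃ K > (0:ℝ), ∀ t, ‖d t‖ ≤ K * ‖H (d t)‖ := by
    let T : Fl.range →ₗ[ℝ] (E2 × E3 × E1) := H.toLinearMap.comp Fl.range.subtype
    have hT : LinearMap.ker T = ⊥ := by
      rw [LinearMap.ker_eq_bot']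
      rintro ⟨m, hm⟩ h
      have h1 : H m = 0 := h
      rw [hH] at h1
      simp only [Prod.mk_eq_zero] at h1
      obtain ⟨h1, h2, h3⟩ := h1
      have h4 : F m = 0 := by
        rw [hF, h1, h2, h3]; simp
      have := Submodule.disjoint_def.1 hdisj m h4 hm
      exact Subtype.ext this
    obtain ⟨K, hK, hT'⟩ := T.exists_antilipschitzWith hT
    refine ⟨K, hK, fun t => ?_⟩
    have hmem : d t ∈ Fl.range := by
      obtain ⟨v, hv⟩ := hPsub (e t)
      exact ⟨v, by rw [hde]; exact hv⟩
    have := hT'.le_mul_dist ⟨d t, hmem⟩ 0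
    rw [dist_zero_right, map_zero, dist_zero_right] at this
    exact this
  -- Lyapunov
  obtain ⟨ε, hε, hε1, hε2, hε3⟩ : ∃ ε > (0:ℝ), ε * ‖At‖ ^ 2 ≤ 1 / 2 ∧
      ε * (1 + k ^ 2 * ‖St‖ ^ 2) ≤ k / 2 ∧ ε * ‖S‖ ≤ 1 / 2 := by
    have p1 : 0 < 1 + ‖At‖ ^ 2 := by positivity
    have p2 : 0 < 1 + k ^ 2 * ‖St‖ ^ 2 := by positivity
    have p3 : 0 < 1 + ‖S‖ := by positivity
    refine ⟨min (1 / (2 * (1 + ‖At‖ ^ 2)))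
      (min (k / (2 * (1 + k ^ 2 * ‖St‖ ^ 2))) (1 / (2 * (1 + ‖S‖)))), by positivity, ?_, ?_, ?_⟩
    · calc _ ≤ 1 / (2 * (1 + ‖At‖ ^ 2)) * (1 + ‖At‖ ^ 2) := by
            apply mul_le_mul (min_le_left _ _) (by linarith) (by positivity) (by positivity)
        _ = 1 / 2 := by field_simp
    · calc _ ≤ k / (2 * (1 + k ^ 2 * ‖St‖ ^ 2)) * (1 + k ^ 2 * ‖St‖ ^ 2) := by
            apply mul_le_mul ((min_le_right _ _).trans (min_le_left _ _)) le_rfl (by positivity) (by positivity)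
        _ = k / 2 := by field_simp
    · calc _ ≤ 1 / (2 * (1 + ‖S‖)) * (1 + ‖S‖) := by
            apply mul_le_mul ((min_le_right _ _).trans (min_le_right _ _)) (by linarith) (by positivity) (by positivity)
        _ = 1 / 2 := by field_simp
  let V : ℝ → ℝ := fun t => ‖(d t).1‖ ^ 2 + ‖(d t).2.1‖ ^ 2 + ‖(d t).2.2‖ ^ 2
  let N : ℝ → ℝ := fun t => ‖(H (d t)).1‖ ^ 2 + ‖(H (d t)).2.1‖ ^ 2 + ‖(H (d t)).2.2‖ ^ 2
  have hVN : ∀ t, V t ≤ 3 * K ^ 2 * N t := by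
    intro t
    have h1 : ‖(d t).1‖ ≤ ‖d t‖ := norm_fst_le _
    have h2 : ‖(d t).2.1‖ ≤ ‖d t‖ := (norm_fst_le _).trans (norm_snd_le _)
    have h3 : ‖(d t).2.2‖ ≤ ‖d t‖ := (norm_snd_le _).trans (norm_snd_le _)
    have h4 : ‖H (d t)‖ ^ 2 ≤ N t := by
      show _ ≤ ‖(H (d t)).1‖ ^ 2 + ‖(H (d t)).2.1‖ ^ 2 + ‖(H (d t)).2.2‖ ^ 2
      generalize H (d t) = h
      have a1 := sq_nonneg ‖h.1‖
      have a2 := sq_nonneg ‖h.2.1‖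
      have a3 := sq_nonneg ‖h.2.2‖
      rw [Prod.norm_def, Prod.norm_def]
      rcases max_cases ‖h.1‖ (max ‖h.2.1‖ ‖h.2.2‖) with ⟨h, _⟩ | ⟨h, _⟩
      · rw [h]; linarith
      · rw [h]
        rename_i h' _
        rcases max_cases ‖h'.2.1‖ ‖h'.2.2‖ with ⟨h, _⟩ | ⟨h, _⟩ <;> rw [h] <;> linarith
    have h5 : ‖d t‖ ^ 2 ≤ K ^ 2 * ‖H (d t)‖ ^ 2 := by
      rw [← mul_pow]; exact pow_le_pow_left₀ (norm_nonneg _) (hKb t) 2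
    have h6 : V t ≤ 3 * ‖d t‖ ^ 2 := by
      have := pow_le_pow_left₀ (norm_nonneg _) h1 2
      have := pow_le_pow_left₀ (norm_nonneg _) h2 2
      have := pow_le_pow_left₀ (norm_nonneg _) h3 2
      show ‖(d t).1‖ ^ 2 + ‖(d t).2.1‖ ^ 2 + ‖(d t).2.2‖ ^ 2 ≤ _
      linarith
    have := mul_le_mul_of_nonneg_left h4 (sq_nonneg K)
    linarith
  let Q : ℝ → ℝ := fun t => ⟪(d t).1, (d t).1⟫_ℝ + ⟪(d t).2.1, (d t).2.1⟫_ℝ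
    + ⟪(d t).2.2, (d t).2.2⟫_ℝ + 2 * ε * ⟪(d t).2.2, S (d t).1⟫_ℝ
  have hQV : ∀ t, V t ≤ 2 * Q t ∧ Q t ≤ 2 * V t := by
    intro t
    have h1 : |⟪(d t).2.2, S (d t).1⟫_ℝ| ≤ ‖(d t).2.2‖ * (‖S‖ * ‖(d t).1‖) :=
      (abs_real_inner_le_norm _ _).trans
        (mul_le_mul_of_nonneg_left (S.le_opNorm _) (norm_nonneg _))
    have h2 : ε * |⟪(d t).2.2, S (d t).1⟫_ℝ| ≤ 1 / 2 * (‖(d t).2.2‖ * ‖(d t).1‖) := by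
      calc _ ≤ ε * (‖(d t).2.2‖ * (‖S‖ * ‖(d t).1‖)) := mul_le_mul_of_nonneg_left h1 hε.le
        _ = ε * ‖S‖ * (‖(d t).2.2‖ * ‖(d t).1‖) := by ring
        _ ≤ _ := mul_le_mul_of_nonneg_right hε3 (by positivity)
    have h3 : |ε * ⟪(d t).2.2, S (d t).1⟫_ℝ| ≤ 1 / 2 * (‖(d t).2.2‖ * ‖(d t).1‖) := by
      rwa [abs_mul, abs_of_pos hε]
    obtain ⟨h4, h5⟩ := abs_le.1 h3
    have h6 : Q t = V t + 2 * (ε * ⟪(d t).2.2, S (d t).1⟫_ℝ) := by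
      show ⟪(d t).1, (d t).1⟫_ℝ + ⟪(d t).2.1, (d t).2.1⟫_ℝ
        + ⟪(d t).2.2, (d t).2.2⟫_ℝ + 2 * ε * ⟪(d t).2.2, S (d t).1⟫_ℝ = 
        ‖(d t).1‖ ^ 2 + ‖(d t).2.1‖ ^ 2 + ‖(d t).2.2‖ ^ 2 + _
      simp only [real_inner_self_eq_norm_sq]
      ring
    have h7 : 2 * (‖(d t).2.2‖ * ‖(d t).1‖) ≤ V t := by
      show _ ≤ ‖(d t).1‖ ^ 2 + ‖(d t).2.1‖ ^ 2 + ‖(d t).2.2‖ ^ 2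
      nlinarith [sq_nonneg (‖(d t).2.2‖ - ‖(d t).1‖), sq_nonneg ‖(d t).2.1‖]
    constructor <;> linarith
  let Q' : ℝ → ℝ := fun t => 2 * (-‖(H (d t)).1‖ ^ 2 - (k - ε) * ‖(H (d t)).2.1‖ ^ 2
    - ε * ‖(H (d t)).2.2‖ ^ 2
    - ε * ⟪(H (d t)).2.2, At (H (d t)).1 + k • St (H (d t)).2.1⟫_ℝ)
  have hQ' : ∀ t, HasDerivAt Q (Q' t) t := by
    intro t
    have d1 : HasDerivAt (fun t => (d t).1) (F (d t)).1 t :=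
      (ContinuousLinearMap.fst ℝ E1 (E2 × E3)).hasFDerivAt.comp_hasDerivAt t (hd t)
    have d23 : HasDerivAt (fun t => (d t).2) (F (d t)).2 t :=
      (ContinuousLinearMap.snd ℝ E1 (E2 × E3)).hasFDerivAt.comp_hasDerivAt t (hd t)
    have d2 : HasDerivAt (fun t => (d t).2.1) (F (d t)).2.1 t :=
      (ContinuousLinearMap.fst ℝ E2 E3).hasFDerivAt.comp_hasDerivAt t d23
    have d3 : HasDerivAt (fun t => (d t).2.2) (F (d t)).2.2 t :=
      (ContinuousLinearMap.snd ℝ E2 E3).hasFDerivAt.comp_hasDerivAt t d23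
    have d4 : HasDerivAt (fun t => S (d t).1) (S (F (d t)).1) t :=
      S.hasFDerivAt.comp_hasDerivAt t d1
    have := (((d1.inner ℝ d1).add (d2.inner ℝ d2)).add (d3.inner ℝ d3)).add
      ((d3.inner ℝ d4).const_mul (2 * ε))
    refine HasDerivAt.congr_deriv (f := Q) this (Eq.symm ?_)
    show 2 * (-‖(H (d t)).1‖ ^ 2 - (k - ε) * ‖(H (d t)).2.1‖ ^ 2
      - ε * ‖(H (d t)).2.2‖ ^ 2
      - ε * ⟪(H (d t)).2.2, At (H (d t)).1 + k • St (H (d t)).2.1⟫_ℝ) = _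
    rw [hF, hH]
    generalize d t = v
    obtain ⟨X, W, U⟩ := v
    simp only
    have c1 : ⟪X, -(At (A X - M W)) - k • St (S X) - St U⟫_ℝ
        = -⟪A X - M W, A X⟫_ℝ - k * ⟪S X, S X⟫_ℝ - ⟪U, S X⟫_ℝ := by
      rw [real_inner_comm]
      simp only [inner_sub_left, inner_neg_left, real_inner_smul_left, hA, hS]
    have c2 : ⟪W, M (A X - M W)⟫_ℝ = ⟪A X - M W, M W⟫_ℝ := by
      rw [real_inner_comm, hM]
    have c3 : ⟪U, S (-(At (A X - M W)) - k • St (S X) - St U)⟫_ℝ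
        = - ⟪St U, At (A X - M W) + k • St (S X)⟫_ℝ - ⟪St U, St U⟫_ℝ := by
      rw [← hS]
      simp only [inner_sub_right, inner_neg_right, inner_add_right]
      ring
    have c4 : ⟪A X - M W, A X - M W⟫_ℝ = ⟪A X - M W, A X⟫_ℝ - ⟪A X - M W, M W⟫_ℝ :=
      inner_sub_right _ _ _
    rw [real_inner_comm X (_ - _), real_inner_comm W (M _)] 
    rw [c1, c2, c3, real_inner_comm U (S X)]
    simp only [← real_inner_self_eq_norm_sq]
    rw [c4]
    ring
  obtain ⟨δ, hδ, hδQ⟩ : ∃ δ > (0:ℝ), ∀ t, Q' t ≤ -δ * N t := by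
    refine ⟨min 1 (min k ε), by positivity, fun t => ?_⟩
    have m1 : min 1 (min k ε) ≤ 1 := min_le_left _ _
    have m2 : min 1 (min k ε) ≤ k := (min_le_right _ _).trans (min_le_left _ _)
    have m3 : min 1 (min k ε) ≤ ε := (min_le_right _ _).trans (min_le_right _ _)
    generalize min 1 (min k ε) = δ at m1 m2 m3
    show 2 * (-‖(H (d t)).1‖ ^ 2 - (k - ε) * ‖(H (d t)).2.1‖ ^ 2
      - ε * ‖(H (d t)).2.2‖ ^ 2
      - ε * ⟪(H (d t)).2.2, At (H (d t)).1 + k • St (H (d t)).2.1⟫_ℝ) ≤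
      -δ * (‖(H (d t)).1‖ ^ 2 + ‖(H (d t)).2.1‖ ^ 2 + ‖(H (d t)).2.2‖ ^ 2)
    generalize H (d t) = v
    obtain ⟨r, y, z⟩ := v
    simp only
    have b1 : ‖At r‖ ≤ ‖At‖ * ‖r‖ := At.le_opNorm _
    have b2 : ‖St y‖ ≤ ‖St‖ * ‖y‖ := St.le_opNorm _
    have b3 : ‖At r + k • St y‖ ≤ ‖At‖ * ‖r‖ + k * (‖St‖ * ‖y‖) := by
      refine (norm_add_le _ _).trans (add_le_add b1 ?_)
      rw [norm_smul, Real.norm_of_nonneg hk.le]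
      exact mul_le_mul_of_nonneg_left b2 hk.le
    have b4 : -⟪z, At r + k • St y⟫_ℝ ≤ ‖z‖ * (‖At‖ * ‖r‖ + k * (‖St‖ * ‖y‖)) :=
      (neg_le_abs _).trans ((abs_real_inner_le_norm _ _).trans
        (mul_le_mul_of_nonneg_left b3 (norm_nonneg _)))
    have b5 : -⟪z, At r + k • St y⟫_ℝ ≤ 1 / 2 * ‖z‖ ^ 2 + ‖At‖ ^ 2 * ‖r‖ ^ 2
        + k ^ 2 * ‖St‖ ^ 2 * ‖y‖ ^ 2 := by
      refine b4.trans ?_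
      nlinarith [sq_nonneg (‖z‖ - 2 * (‖At‖ * ‖r‖)), sq_nonneg (‖z‖ - 2 * (k * (‖St‖ * ‖y‖)))]
    have b6 := mul_le_mul_of_nonneg_left b5 hε.le
    have s1 := sq_nonneg ‖r‖
    have s2 := sq_nonneg ‖y‖
    have s3 := sq_nonneg ‖z‖
    have t1 := mul_le_mul_of_nonneg_right hε1 s1
    have t2 := mul_le_mul_of_nonneg_right hε2 s2
    have u1 := mul_le_mul_of_nonneg_right m1 s1
    have u2 := mul_le_mul_of_nonneg_right m2 s2
    have u3 := mul_le_mul_of_nonneg_right m3 s3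
    linarith
  have hdecay := aux_decay Q Q' (δ / (6 * K ^ 2)) hQ' (by
    intro t
    have h1 := hδQ t
    have h2 := hVN t
    have h3 := (hQV t).2
    have h4 : δ / (6 * K ^ 2) * Q t ≤ δ * N t := by
      calc _ ≤ δ / (6 * K ^ 2) * (6 * K ^ 2 * N t) :=
            mul_le_mul_of_nonneg_left (by linarith) (by positivity)
        _ = δ * N t := by field_simp
    linarith)
  rw [hF] at hFqs
  simp only [Prod.mk.injEq] at hFqs
  obtain ⟨g1, g2, g3⟩ := hFqs
  refine ⟨qs.1, qs.2.1, qs.2.2, g3, ?_, ?_, ?_⟩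
  · rw [sub_right_comm, map_sub, g2, sub_self]
  · rw [g3] at g1
    rw [sub_right_comm, map_sub]
    simp only [map_zero, smul_zero, sub_zero] at g1
    have : At (A qs.1 - M qs.2.1) = At b - St qs.2.2 := by
      rw [← neg_inj]
      rw [sub_eq_iff_eq_add] at g1
      rw [g1]; abel
    rw [this]; abel
  · have hc : 0 < δ / (6 * K ^ 2) := by positivity
    set c := δ / (6 * K ^ 2)
    have hQ0 : 0 ≤ Q 0 := by
      have h1 := (hQV 0).1
      have : 0 ≤ V 0 := by positivity
      linarith
    refine ⟨Real.sqrt (2 * Q 0) + 1, by positivity, c / 2, by positivity, fun t ht => ?_⟩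
    have h1 := hdecay t ht
    have h2 := (hQV t).1
    have h3 : ‖x t - qs.1‖ ^ 2 ≤ V t := by
      show ‖(d t).1‖ ^ 2 ≤ ‖(d t).1‖ ^ 2 + ‖(d t).2.1‖ ^ 2 + ‖(d t).2.2‖ ^ 2
      nlinarith [sq_nonneg ‖(d t).2.1‖, sq_nonneg ‖(d t).2.2‖]
    have h4 : ‖x t - qs.1‖ ^ 2 ≤ (Real.sqrt (2 * Q 0) * Real.exp (-(c / 2) * t)) ^ 2 := by
      rw [mul_pow, Real.sq_sqrt (by linarith), ← Real.exp_nat_mul]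
      have : ((2:ℕ):ℝ) * (-(c / 2) * t) = -c * t := by push_cast; ring
      rw [this]; linarith
    have h5 := abs_le_of_sq_le_sq h4 (by positivity)
    have h6 := le_of_abs_le h5
    have := Real.exp_pos (-(c / 2) * t)
    rw [add_mul, one_mul]
    linarith

noncomputable def auxCLM {Y Z : Type*} [Fintype Y] [Fintype Z] (B : Matrix Y Z ℝ) :
    EuclideanSpace ℝ Z →L[ℝ] EuclideanSpace ℝ Y :=
  (EuclideanSpace.equiv Y ℝ).symm.toContinuousLinearMap.comp
    ((LinearMap.toContinuousLinearMap (Matrix.mulVecLin B)).comp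
      (EuclideanSpace.equiv Z ℝ).toContinuousLinearMap)

theorem auxCLM_apply {Y Z : Type*} [Fintype Y] [Fintype Z] (B : Matrix Y Z ℝ)
    (v : EuclideanSpace ℝ Z) : auxCLM B v = WithLp.toLp 2 (B *ᵥ WithLp.ofLp v) := rfl

theorem aux_hin {Y Z : Type*} [Fintype Y] [Fintype Z] (B : Matrix Y Z ℝ)
    (x : EuclideanSpace ℝ Z) (y : EuclideanSpace ℝ Y) :
    ⟪auxCLM Bᵀ y, x⟫_ℝ = ⟪y, auxCLM B x⟫_ℝ := by
  rw [auxCLM_apply, auxCLM_apply, EuclideanSpace.inner_eq_star_dotProduct,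
    EuclideanSpace.inner_eq_star_dotProduct]
  simp only [star_trivial]
  rw [Matrix.dotProduct_mulVec, Matrix.vecMul_transpose]

theorem aux_hder {Y : Type*} [Fintype Y] (f : ℝ → Y → ℝ) (f' : Y → ℝ) (t : ℝ)
    (h : HasDerivAt f f' t) :
    HasDerivAt (fun s => (WithLp.toLp 2 (f s) : EuclideanSpace ℝ Y)) (WithLp.toLp 2 f') t :=
  (EuclideanSpace.equiv Y ℝ).symm.toContinuousLinearMap.hasFDerivAt.comp_hasDerivAt t h

theorem aux_mat {X R U : Type*} [Fintype X] [Fintype R] [Fintype U]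
    (A : Matrix R X ℝ) (M : Matrix R R ℝ) (hM : Mᵀ = M)
    (S : Matrix U X ℝ) (k : ℝ) (hk : 0 < k) (b : R → ℝ) (x : ℝ → X → ℝ) (w : ℝ → R → ℝ)
    (u : ℝ → U → ℝ)
    (hx : ∀ t, HasDerivAt x (-(Aᵀ *ᵥ (A *ᵥ x t - b - M *ᵥ w t)) - k • (Sᵀ *ᵥ (S *ᵥ x t))
      - Sᵀ *ᵥ u t) t)
    (hw : ∀ t, HasDerivAt w (M *ᵥ (A *ᵥ x t - b - M *ᵥ w t)) t)
    (hu : ∀ t, HasDerivAt u (S *ᵥ x t) t) :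
    ∃ xs ws us, S *ᵥ xs = 0 ∧ M *ᵥ (A *ᵥ xs - b - M *ᵥ ws) = 0 ∧
      Aᵀ *ᵥ (A *ᵥ xs - b - M *ᵥ ws) + Sᵀ *ᵥ us = 0 ∧
      ∃ C > (0:ℝ), ∃ c > (0:ℝ), ∀ t ≥ (0:ℝ), ‖x t - xs‖ ≤ C * Real.exp (-c * t) := by
  obtain ⟨xs, ws, us, h1, h2, h3, C, hC, c, hc, hb⟩ := aux_abs
    (auxCLM A)
    (auxCLM Aᵀ) (aux_hin A)
    (auxCLM M)
    (by intro x y; have := aux_hin M x y; rwa [hM] at this)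
    (auxCLM S)
    (auxCLM Sᵀ) (aux_hin S) k hk
    (WithLp.toLp 2 b) (fun t => WithLp.toLp 2 (x t)) (fun t => WithLp.toLp 2 (w t))
    (fun t => WithLp.toLp 2 (u t)) (fun t => aux_hder _ _ _ (hx t)) (fun t => aux_hder _ _ _ (hw t))
    (fun t => aux_hder _ _ _ (hu t))
  refine ⟨WithLp.ofLp xs, WithLp.ofLp ws, WithLp.ofLp us, congrArg WithLp.ofLp h1,
    congrArg WithLp.ofLp h2, congrArg WithLp.ofLp h3, C, hC, c, hc, fun t ht => ?_⟩
  refine le_trans ?_ (hb t ht)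
  rw [pi_norm_le_iff_of_nonneg (norm_nonneg _)]
  intro i
  exact PiLp.norm_apply_le (WithLp.toLp 2 (x t) - xs) i

open scoped MatrixOrder Matrix.Norms.L2Operator in
theorem aux_factor {n : Type*} [Fintype n] [DecidableEq n] {N : Matrix n n ℝ}
    (h : N.PosSemidef) : ∃ B : Matrix n n ℝ, N = Bᵀ * B := by
  obtain ⟨B, hB⟩ := CStarAlgebra.nonneg_iff_eq_star_mul_self.1 (Matrix.nonneg_iff_posSemidef.2 h)
  exact ⟨B, by rw [hB, Matrix.star_eq_conjTranspose,
    Matrix.conjTranspose_eq_transpose_of_trivial]⟩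

section conc

variable {p q : ℕ} {mdim : Fin p → ℕ} {ndim : Fin q → ℕ}

theorem aux_Lhat_mulVec (B : Matrix (Fin p) (Fin p) ℝ) (v : ColIx p q ndim → ℝ)
    (j : Fin q) (i : Fin p) (c : Fin (ndim j)) :
    (Lhat B *ᵥ v) ⟨j, (i, c)⟩ = (B *ᵥ fun i' => v ⟨j, (i', c)⟩) i := by
  simp only [Matrix.mulVec, dotProduct, Lhat]
  rw [Fintype.sum_sigma, Finset.sum_eq_single j]
  · rw [Fintype.sum_prod_type]
    refine Finset.sum_congr rfl fun i' _ => ?_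
    rw [Finset.sum_eq_single c]
    · simp
    · intro c' _ h
      rw [if_neg, zero_mul]
      intro h'
      simp at h'
      exact h h'.symm
    · simp
  · intro j' _ h
    refine Finset.sum_eq_zero fun y _ => ?_
    rw [if_neg, zero_mul]
    intro h'
    exact h (congrArg Sigma.fst h').symm
  · simp

theorem aux_Lhat_transpose (B : Matrix (Fin p) (Fin p) ℝ) :
    (Lhat B : Matrix (ColIx p q ndim) (ColIx p q ndim) ℝ)ᵀ = Lhat Bᵀ := by
  ext r c
  simp only [Matrix.transpose_apply, Lhat]
  simp only [eq_comm]

theorem aux_Lhat_mul (B : Matrix (Fin p) (Fin p) ℝ) (v : ColIx p q ndim → ℝ) :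
    (Lhat B)ᵀ *ᵥ (Lhat B *ᵥ v) = Lhat (Bᵀ * B) *ᵥ v := by
  rw [aux_Lhat_transpose]
  ext ⟨j, i, c⟩
  rw [aux_Lhat_mulVec, aux_Lhat_mulVec, ← Matrix.mulVec_mulVec]
  congr 1
  ext i'
  rw [aux_Lhat_mulVec]

theorem aux_Lchat_mulVec (B : Matrix (Fin q) (Fin q) ℝ) (v : RowIx p q mdim → ℝ)
    (j : Fin q) (a : Σ i : Fin p, Fin (mdim i)) :
    (Lchat B *ᵥ v) (j, a) = (B *ᵥ fun j' => v (j', a)) j := by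
  simp only [Matrix.mulVec, dotProduct, Lchat]
  rw [Fintype.sum_prod_type]
  refine Finset.sum_congr rfl fun j' _ => ?_
  rw [Finset.sum_eq_single a]
  · simp
  · intro a' _ h
    rw [if_neg (Ne.symm h), zero_mul]
  · simp

theorem aux_Ahat_stack (A : Matrix (Σ i : Fin p, Fin (mdim i)) (Σ j : Fin q, Fin (ndim j)) ℝ)
    (y : (Σ j : Fin q, Fin (ndim j)) → ℝ) (j : Fin q) (a : Σ i : Fin p, Fin (mdim i)) :
    (Ahat A *ᵥ stackVec y) (j, a) = ∑ c, A a ⟨j, c⟩ * y ⟨j, c⟩ := by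
  simp only [Matrix.mulVec, dotProduct, Ahat, stackVec]
  rw [Fintype.sum_sigma, Finset.sum_eq_single j]
  · rw [Fintype.sum_prod_type, Finset.sum_eq_single a.1]
    · simp
    · intro i' _ h
      refine Finset.sum_eq_zero fun y _ => ?_
      rw [if_neg, zero_mul]
      intro h'
      exact h h'.2.symm
    · simp
  · intro j' _ h
    refine Finset.sum_eq_zero fun y _ => ?_
    rw [if_neg, zero_mul]
    intro h'
    exact h h'.1.symm
  · simp

theorem aux_Ahat_stack_sum
    (A : Matrix (Σ i : Fin p, Fin (mdim i)) (Σ j : Fin q, Fin (ndim j)) ℝ)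
    (y : (Σ j : Fin q, Fin (ndim j)) → ℝ) (a : Σ i : Fin p, Fin (mdim i)) :
    ∑ j, (Ahat A *ᵥ stackVec y) (j, a) = (A *ᵥ y) a := by
  simp only [aux_Ahat_stack]
  rw [Matrix.mulVec, dotProduct, Fintype.sum_sigma]

theorem aux_gram {Y Z : Type*} [Fintype Y] [Fintype Z] (S : Matrix Y Z ℝ) (v : Z → ℝ)
    (h : Sᵀ *ᵥ (S *ᵥ v) = 0) : S *ᵥ v = 0 := by
  have h1 : (S *ᵥ v) ⬝ᵥ (S *ᵥ v) = 0 := by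
    rw [Matrix.dotProduct_mulVec, ← Matrix.mulVec_transpose, h, zero_dotProduct]
  exact dotProduct_self_eq_zero.1 h1

theorem aux_LS {ι κ : Type*} [Fintype ι] [Fintype κ] (A : Matrix ι κ ℝ) (b : ι → ℝ)
    (x : κ → ℝ) (h : ∀ y, (A *ᵥ y) ⬝ᵥ (A *ᵥ x - b) = 0) : IsLSSol A b x := by
  intro y
  have h1 : A *ᵥ y - b = A *ᵥ (y - x) + (A *ᵥ x - b) := by
    rw [Matrix.mulVec_sub]; abel
  rw [h1, add_dotProduct, dotProduct_add, dotProduct_add, h (y - x),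
    dotProduct_comm (A *ᵥ x - b) (A *ᵥ (y - x)), h (y - x)]
  have : 0 ≤ (A *ᵥ (y - x)) ⬝ᵥ (A *ᵥ (y - x)) := by
    simpa using dotProduct_star_self_nonneg (A *ᵥ (y - x))
  linarith

/-- An equilibrium of the flow gives a least-squares solution. -/
theorem aux_equil (hp : 0 < p) (hq : 0 < q)
    (A : Matrix (Σ i : Fin p, Fin (mdim i)) (Σ j : Fin q, Fin (ndim j)) ℝ)
    (bblk : (i : Fin p) → Fin q → Fin (mdim i) → ℝ)
    (G : SimpleGraph (Fin p)) [DecidableRel G.Adj] (hG : G.Connected)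
    (Gc : SimpleGraph (Fin q)) [DecidableRel Gc.Adj] (hGc : Gc.Connected)
    (M : Matrix (RowIx p q mdim) (RowIx p q mdim) ℝ) (hMt : Mᵀ = M)
    (hM2 : M * M = Lchat (Gc.lapMatrix ℝ))
    (S : Matrix (ColIx p q ndim) (ColIx p q ndim) ℝ) (k : ℝ)
    (hk : 0 < k) (hS : ∀ v, Sᵀ *ᵥ (S *ᵥ v) = k • (Lhat (G.lapMatrix ℝ) *ᵥ v))
    (xs : ColIx p q ndim → ℝ) (ws : RowIx p q mdim → ℝ) (us : ColIx p q ndim → ℝ)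
    (h1 : S *ᵥ xs = 0) (h2 : M *ᵥ (Ahat A *ᵥ xs - bhat bblk - M *ᵥ ws) = 0)
    (h3 : (Ahat A)ᵀ *ᵥ (Ahat A *ᵥ xs - bhat bblk - M *ᵥ ws) + Sᵀ *ᵥ us = 0) :
    ∃ xstar, IsLSSol A (bvec bblk) xstar ∧ xs = stackVec xstar := by
  let i0 : Fin p := ⟨0, hp⟩
  let j0 : Fin q := ⟨0, hq⟩
  -- consensus
  have hL : Lhat (G.lapMatrix ℝ) *ᵥ xs = 0 := by
    have := hS xs
    rw [h1, Matrix.mulVec_zero] at this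
    exact (smul_eq_zero.1 this.symm).resolve_left hk.ne'
  have hcons : xs = stackVec (fun a => xs ⟨a.1, (i0, a.2)⟩) := by
    ext ⟨j, i, c⟩
    have h : G.lapMatrix ℝ *ᵥ (fun i' => xs ⟨j, (i', c)⟩) = 0 := by
      ext i'
      rw [← aux_Lhat_mulVec, hL]; rfl
    exact (G.lapMatrix_mulVec_eq_zero_iff_forall_reachable).1 h i i0 (hG.preconnected i i0)
  generalize (fun a : Σ j : Fin q, Fin (ndim j) => xs ⟨a.1, (i0, a.2)⟩) = x at hcons
  refine ⟨x, ?_, hcons⟩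
  obtain ⟨r, hr⟩ : ∃ r, r = Ahat A *ᵥ xs - bhat bblk - M *ᵥ ws := ⟨_, rfl⟩
  rw [← hr] at h2 h3
  have hrc : ∀ j a, r (j, a) = r (j0, a) := by
    intro j a
    have h : Gc.lapMatrix ℝ *ᵥ (fun j' => r (j', a)) = 0 := by
      ext j'
      rw [← aux_Lchat_mulVec, ← hM2, ← Matrix.mulVec_mulVec, h2, Matrix.mulVec_zero]; rfl
    exact (Gc.lapMatrix_mulVec_eq_zero_iff_forall_reachable).1 h j j0 (hGc.preconnected j j0)
  -- column sums of `M ws` vanish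
  have hsum : ∀ a, ∑ j, (M *ᵥ ws) (j, a) = 0 := by
    intro a
    let e : RowIx p q mdim → ℝ := fun s => if s.2 = a then 1 else 0
    have he : M *ᵥ e = 0 := by
      apply aux_gram
      rw [hMt, Matrix.mulVec_mulVec, hM2]
      ext ⟨j, a'⟩
      rw [aux_Lchat_mulVec]
      have h : Gc.lapMatrix ℝ *ᵥ (fun j' => e (j', a')) = 0 :=
        (Gc.lapMatrix_mulVec_eq_zero_iff_forall_reachable).2 (fun _ _ _ => rfl)
      rw [h]; rfl
    have h4 : e ⬝ᵥ (M *ᵥ ws) = 0 := by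
      rw [Matrix.dotProduct_mulVec, ← Matrix.mulVec_transpose, hMt, he, zero_dotProduct]
    rw [← h4, dotProduct, Fintype.sum_prod_type]
    refine Finset.sum_congr rfl fun j _ => ?_
    simp [e]
  have hres : ∀ a, (A *ᵥ x - bvec bblk) a = q * r (j0, a) := by
    intro a
    have h4 : ∑ j, r (j, a) = q * r (j0, a) := by
      simp [hrc]
    rw [← h4, hr, hcons]
    simp only [Pi.sub_apply, Finset.sum_sub_distrib, hsum, aux_Ahat_stack_sum, sub_zero]
    rfl
  apply aux_LS
  intro y
  have hSy : S *ᵥ stackVec y = 0 := by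
    apply aux_gram
    rw [hS]
    have : Lhat (G.lapMatrix ℝ) *ᵥ (stackVec y : ColIx p q ndim → ℝ) = 0 := by
      ext ⟨j, i, c⟩
      rw [aux_Lhat_mulVec]
      have h : G.lapMatrix ℝ *ᵥ (fun i' : Fin p => (stackVec y : ColIx p q ndim → ℝ) ⟨j, (i', c)⟩) = 0 :=
        (G.lapMatrix_mulVec_eq_zero_iff_forall_reachable).2 (fun _ _ _ => rfl)
      rw [h]; rfl
    rw [this, smul_zero]
  have h5 : (Ahat A *ᵥ stackVec y) ⬝ᵥ r = 0 := by
    have h6 : stackVec y ⬝ᵥ ((Ahat A)ᵀ *ᵥ r + Sᵀ *ᵥ us) = 0 := by rw [h3, dotProduct_zero]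
    rw [dotProduct_add, Matrix.dotProduct_mulVec, Matrix.dotProduct_mulVec,
      Matrix.vecMul_transpose, Matrix.vecMul_transpose, hSy, zero_dotProduct, add_zero] at h6
    exact h6
  have h7 : (Ahat A *ᵥ stackVec y) ⬝ᵥ r = ∑ a, (A *ᵥ y) a * r (j0, a) := by
    rw [dotProduct, Fintype.sum_prod_type_right]
    refine Finset.sum_congr rfl fun a _ => ?_
    rw [← aux_Ahat_stack_sum, Finset.sum_mul]
    refine Finset.sum_congr rfl fun j _ => ?_
    rw [hrc j a]
  rw [h7] at h5
  rw [dotProduct]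
  simp only [hres]
  have h8 : ∀ a, (A *ᵥ y) a * (q * r (j0, a)) = q * ((A *ᵥ y) a * r (j0, a)) := fun a => by ring
  simp only [h8]
  rw [← Finset.mul_sum, h5, mul_zero]

end conc

end aux

/-- **Theorem 1 (CT-D-LS convergence).** For any `k_P, k_I > 0` there is a least-squares
solution `x*` of `A x = b` such that the solution of the CT-D-LS flow
`x̂' = −Âᵀ(Âx̂ − b̂ − L̂_c^{1/2}ω̂) − k_P L̂ x̂ − k_I ẑ`,
`ω̂' = L̂_c^{1/2}(Âx̂ − b̂ − L̂_c^{1/2}ω̂)`, `ẑ' = L̂ x̂`, started at the origin, converges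
exponentially to the stacked (consensus) vector `x̂*`. -/
theorem ctdls_exponential_convergence
    (p q : ℕ) (hp : 0 < p) (hq : 0 < q)
    (mdim : Fin p → ℕ) (ndim : Fin q → ℕ)
    (hmdim : ∀ i, 0 < mdim i) (hndim : ∀ j, 0 < ndim j)
    (A : Matrix (Σ i : Fin p, Fin (mdim i)) (Σ j : Fin q, Fin (ndim j)) ℝ)
    (bblk : (i : Fin p) → Fin q → Fin (mdim i) → ℝ)
    (G : SimpleGraph (Fin p)) [DecidableRel G.Adj] (hG : G.Connected)
    (Gc : SimpleGraph (Fin q)) [DecidableRel Gc.Adj] (hGc : Gc.Connected)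
    -- the (unique) positive semidefinite square root of `L̂_c`
    (Lchalf : Matrix (RowIx p q mdim) (RowIx p q mdim) ℝ)
    (hLchalf : Lchalf.PosSemidef ∧ Lchalf * Lchalf = Lchat (Gc.lapMatrix ℝ))
    -- tunable parameters
    (kP kI : ℝ) (hkP : 0 < kP) (hkI : 0 < kI)
    -- the solution of the CT-D-LS flow with zero initial conditions
    (xh : ℝ → ColIx p q ndim → ℝ) (ωh : ℝ → RowIx p q mdim → ℝ)
    (zh : ℝ → ColIx p q ndim → ℝ)
    (hx0 : xh 0 = 0) (hω0 : ωh 0 = 0) (hz0 : zh 0 = 0)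
    (hxdot : ∀ t : ℝ, HasDerivAt xh
      (-(Ahat A)ᵀ.mulVec ((Ahat A).mulVec (xh t) - bhat bblk - Lchalf.mulVec (ωh t))
        - kP • (Lhat (G.lapMatrix ℝ)).mulVec (xh t) - kI • zh t) t)
    (hωdot : ∀ t : ℝ, HasDerivAt ωh
      (Lchalf.mulVec ((Ahat A).mulVec (xh t) - bhat bblk - Lchalf.mulVec (ωh t))) t)
    (hzdot : ∀ t : ℝ, HasDerivAt zh ((Lhat (G.lapMatrix ℝ)).mulVec (xh t)) t) :
    ∃ xstar : (Σ j : Fin q, Fin (ndim j)) → ℝ,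
      IsLSSol A (bvec bblk) xstar ∧
        ∃ C > (0:ℝ), ∃ c > (0:ℝ), ∀ t ≥ (0:ℝ),
          ‖xh t - stackVec xstar‖ ≤ C * Real.exp (-c * t) := by
  classical
  obtain ⟨hMp, hM2⟩ := hLchalf
  have hMt : Lchalfᵀ = Lchalf := by
    have := hMp.isHermitian.eq
    rwa [Matrix.conjTranspose_eq_transpose_of_trivial] at this
  obtain ⟨B, hB⟩ : ∃ B : Matrix (Fin p) (Fin p) ℝ, G.lapMatrix ℝ = Bᵀ * B := by
    exact aux_factor (SimpleGraph.posSemidef_lapMatrix ℝ G)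
  let S : Matrix (ColIx p q ndim) (ColIx p q ndim) ℝ := Real.sqrt kI • Lhat B
  have hS : ∀ v, Sᵀ *ᵥ (S *ᵥ v) = kI • (Lhat (G.lapMatrix ℝ) *ᵥ v) := by
    intro v
    simp only [S, Matrix.transpose_smul, Matrix.smul_mulVec, Matrix.mulVec_smul]
    rw [aux_Lhat_mul, ← hB, smul_smul, Real.mul_self_sqrt hkI.le]
  have hxc : Continuous xh := continuous_iff_continuousAt.2 fun t => (hxdot t).continuousAt
  let y : ℝ → ColIx p q ndim → ℝ := fun t => ∫ s in (0:ℝ)..t, xh s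
  have hy : ∀ t, HasDerivAt y (xh t) t := fun t =>
    intervalIntegral.integral_hasDerivAt_right (hxc.intervalIntegrable _ _)
      (hxc.stronglyMeasurableAtFilter _ _) hxc.continuousAt
  have hmv : ∀ (N : Matrix (ColIx p q ndim) (ColIx p q ndim) ℝ) t,
      HasDerivAt (fun s => N *ᵥ y s) (N *ᵥ xh t) t := fun N t =>
    (LinearMap.toContinuousLinearMap (Matrix.mulVecLin N)).hasFDerivAt.comp_hasDerivAt t (hy t)
  have hz : ∀ t, zh t = Lhat (G.lapMatrix ℝ) *ᵥ y t := by
    intro t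
    have hd : ∀ t, HasDerivAt (fun s => zh s - Lhat (G.lapMatrix ℝ) *ᵥ y s) 0 t := fun t =>
      ((hzdot t).sub (hmv _ t)).congr_deriv (sub_self _)
    have h := is_const_of_deriv_eq_zero (fun t => (hd t).differentiableAt)
      (fun t => (hd t).deriv) t 0
    have hy0 : y 0 = 0 := intervalIntegral.integral_same
    simp only [hz0, hy0, Matrix.mulVec_zero, sub_zero] at h
    exact sub_eq_zero.1 h
  obtain ⟨xs, ws, us, h1, h2, h3, hC⟩ := aux_mat (Ahat A) Lchalf hMt S (kP / kI)
    (by positivity) (bhat bblk) xh ωh (fun t => S *ᵥ y t)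
    (by
      intro t
      refine (hxdot t).congr_deriv ?_
      rw [hS, hS, hz, smul_smul, div_mul_cancel₀ _ hkI.ne'])
    hωdot (hmv S)
  obtain ⟨xstar, hls, rfl⟩ := aux_equil hp hq A bblk G hG Gc hGc Lchalf hMt hM2 S kI hkI hS
    xs ws us h1 h2 h3
  exact ⟨xstar, hls, hC⟩
end

section
/- A matrix A ∈ ℝ^{n×n} is semi-Hurwitz if and only if both of the following hold: (i) there exist symmetric matrices P, Q ∈ ℝ^{n×n} with P positive definite and Q positive semidefinite such that PA + AᵀP + Q = 0, and (ii) A has no eigenvalue λ ∈ ℂ with Re(λ) = 0 and λ ≠ 0. -/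
open Matrix Polynomial

/-- The characteristic polynomial of a real matrix, viewed over `ℂ`. Its roots are the
(complex) eigenvalues of the matrix. -/
noncomputable def charpolyC {ι : Type*} [Fintype ι] [DecidableEq ι]
    (A : Matrix ι ι ℝ) : Polynomial ℂ :=
  (A.charpoly).map (algebraMap ℝ ℂ)

/-- A real square matrix is *semi-Hurwitz* if every (complex) eigenvalue either has negative
real part, or equals `0` and `0` is non-defective. -/
def IsSemiHurwitz {ι : Type*} [Fintype ι] [DecidableEq ι] (A : Matrix ι ι ℝ) : Prop :=
  ∀ μ : ℂ, (charpolyC A).IsRoot μ →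
    μ.re < 0 ∨ (μ = 0 ∧
      Module.finrank ℝ (LinearMap.ker A.mulVecLin) = (charpolyC A).rootMultiplicity 0)

/-! ### Preliminaries on eigenvalues -/

lemma charpolyC_eq {n : ℕ} (A : Matrix (Fin n) (Fin n) ℝ) :
    charpolyC A = (A.map (algebraMap ℝ ℂ)).charpoly := by
  rw [charpolyC, Matrix.charpoly_map]

lemma isRoot_charpoly_iff {n : ℕ} (M : Matrix (Fin n) (Fin n) ℂ) (μ : ℂ) :
    M.charpoly.IsRoot μ ↔ ∃ v : Fin n → ℂ, v ≠ 0 ∧ M *ᵥ v = μ • v := by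
  rw [Polynomial.IsRoot, Matrix.eval_charpoly, ← Matrix.exists_mulVec_eq_zero_iff]
  refine exists_congr fun v => and_congr_right fun _ => ?_
  rw [Matrix.sub_mulVec, sub_eq_zero]
  simp [Matrix.scalar_apply, ← Matrix.smul_one_eq_diagonal, Matrix.smul_mulVec, eq_comm]

lemma finrank_maxGen {n : ℕ} (A : Matrix (Fin n) (Fin n) ℝ) :
    Module.finrank ℝ (Module.End.maxGenEigenspace (Matrix.toLin' A) 0)
      = (charpolyC A).rootMultiplicity 0 := by
  rw [LinearMap.finrank_maxGenEigenspace_eq, Matrix.charpoly_toLin', charpolyC]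
  have h := Polynomial.eq_rootMultiplicity_map (p := A.charpoly)
    (f := algebraMap ℝ ℂ) (algebraMap ℝ ℂ).injective 0
  rw [map_zero] at h
  exact h

lemma mem_maxGen {n : ℕ} (A : Matrix (Fin n) (Fin n) ℝ) (x : Fin n → ℝ) :
    x ∈ Module.End.maxGenEigenspace (Matrix.toLin' A) 0 ↔ ∃ k : ℕ, (A ^ k) *ᵥ x = 0 := by
  rw [Module.End.mem_maxGenEigenspace]
  simp [← Matrix.toLin'_pow]

lemma ker_le_maxGen {n : ℕ} (A : Matrix (Fin n) (Fin n) ℝ) :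
    LinearMap.ker A.mulVecLin ≤ Module.End.maxGenEigenspace (Matrix.toLin' A) 0 := by
  intro x hx
  rw [mem_maxGen]
  exact ⟨1, by simpa using hx⟩

lemma finrank_ker_iff {n : ℕ} (A : Matrix (Fin n) (Fin n) ℝ) :
    Module.finrank ℝ (LinearMap.ker A.mulVecLin) = (charpolyC A).rootMultiplicity 0 ↔
      ∀ (k : ℕ) (x : Fin n → ℝ), (A ^ k) *ᵥ x = 0 → A *ᵥ x = 0 := by
  rw [← finrank_maxGen]
  constructor
  · intro h k x hx
    have h2 := Submodule.eq_of_le_of_finrank_eq (ker_le_maxGen A) h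
    have : x ∈ LinearMap.ker A.mulVecLin := by
      rw [h2, mem_maxGen]; exact ⟨k, hx⟩
    simpa using this
  · intro h
    refine le_antisymm (Submodule.finrank_mono (ker_le_maxGen A)) (Submodule.finrank_mono ?_)
    intro x hx
    rw [mem_maxGen] at hx
    obtain ⟨k, hk⟩ := hx
    simpa using h k x hk

/-! ### From the Lyapunov equation to semi-Hurwitz -/

lemma lyap_nonpos {n : ℕ} {A P Q : Matrix (Fin n) (Fin n) ℝ} (hP : P.PosDef)
    (hQ : Q.PosSemidef) (h : P * A + Aᵀ * P + Q = 0) (x : Fin n → ℝ) :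
    x ⬝ᵥ P *ᵥ (A *ᵥ x) ≤ 0 := by
  have h1 : x ⬝ᵥ (P * A + Aᵀ * P + Q) *ᵥ x = 0 := by simp [h]
  have h2 : 0 ≤ x ⬝ᵥ Q *ᵥ x := by simpa using hQ.dotProduct_mulVec_nonneg x
  have hPt : Pᵀ = P := by simpa [Matrix.IsHermitian] using hP.isHermitian
  have h3 : x ⬝ᵥ (Aᵀ * P) *ᵥ x = x ⬝ᵥ P *ᵥ (A *ᵥ x) := by
    rw [← Matrix.mulVec_mulVec, Matrix.dotProduct_mulVec, Matrix.vecMul_transpose,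
      Matrix.dotProduct_mulVec, ← Matrix.mulVec_transpose, hPt, dotProduct_comm]
  rw [Matrix.add_mulVec, Matrix.add_mulVec, dotProduct_add, dotProduct_add, h3,
    ← Matrix.mulVec_mulVec] at h1
  linarith

lemma posDef_symm {n : ℕ} {P : Matrix (Fin n) (Fin n) ℝ} (hP : P.PosDef) (x y : Fin n → ℝ) :
    x ⬝ᵥ P *ᵥ y = y ⬝ᵥ P *ᵥ x := by
  have hPt : Pᵀ = P := by simpa [Matrix.IsHermitian] using hP.isHermitian
  rw [Matrix.dotProduct_mulVec, ← Matrix.mulVec_transpose, hPt, dotProduct_comm]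

lemma re_nonpos_of_lyap {n : ℕ} {A P Q : Matrix (Fin n) (Fin n) ℝ} (hP : P.PosDef)
    (hQ : Q.PosSemidef) (h : P * A + Aᵀ * P + Q = 0) {μ : ℂ}
    (hμ : (charpolyC A).IsRoot μ) : μ.re ≤ 0 := by
  rw [charpolyC_eq, isRoot_charpoly_iff] at hμ
  obtain ⟨v, hv0, hv⟩ := hμ
  set a : Fin n → ℝ := fun i => (v i).re with ha
  set b : Fin n → ℝ := fun i => (v i).im with hb
  have hAa : A *ᵥ a = μ.re • a - μ.im • b := by
    ext i
    have := congrArg Complex.re (congrFun hv i)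
    simpa [Matrix.mulVec, dotProduct, ha, hb] using this
  have hAb : A *ᵥ b = μ.im • a + μ.re • b := by
    ext i
    have := congrArg Complex.im (congrFun hv i)
    simp [Matrix.mulVec, dotProduct] at this
    simp [Matrix.mulVec, dotProduct, ha, hb]
    linarith
  have h1 := lyap_nonpos hP hQ h a
  have h2 := lyap_nonpos hP hQ h b
  rw [hAa] at h1
  rw [hAb] at h2
  simp only [Matrix.mulVec_add, Matrix.mulVec_sub, Matrix.mulVec_smul, dotProduct_add,
    dotProduct_sub, dotProduct_smul, smul_eq_mul] at h1 h2
  rw [posDef_symm hP b a] at h2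
  have ha' : 0 ≤ a ⬝ᵥ P *ᵥ a := by simpa using hP.posSemidef.dotProduct_mulVec_nonneg a
  have hb' : 0 ≤ b ⬝ᵥ P *ᵥ b := by simpa using hP.posSemidef.dotProduct_mulVec_nonneg b
  have hpos : 0 < a ⬝ᵥ P *ᵥ a + b ⬝ᵥ P *ᵥ b := by
    by_cases ha0 : a = 0
    · have hb0 : b ≠ 0 := by
        intro hb0
        apply hv0
        ext i
        exact Complex.ext (congrFun ha0 i) (congrFun hb0 i)
      have : 0 < b ⬝ᵥ P *ᵥ b := by simpa using hP.dotProduct_mulVec_pos hb0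
      linarith
    · have : 0 < a ⬝ᵥ P *ᵥ a := by simpa using hP.dotProduct_mulVec_pos ha0
      linarith
  by_contra hc
  push Not at hc
  have := mul_pos hc hpos
  linarith

lemma sq_ker_of_lyap {n : ℕ} {A P Q : Matrix (Fin n) (Fin n) ℝ} (hP : P.PosDef)
    (hQ : Q.PosSemidef) (h : P * A + Aᵀ * P + Q = 0) (x : Fin n → ℝ)
    (hx : A *ᵥ (A *ᵥ x) = 0) : A *ᵥ x = 0 := by
  by_contra hy
  set y := A *ᵥ x with hyd
  have hpos : 0 < y ⬝ᵥ P *ᵥ y := by simpa using hP.dotProduct_mulVec_pos hy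
  have h1 := lyap_nonpos hP hQ h
    (x + ((1 - x ⬝ᵥ P *ᵥ y) / (y ⬝ᵥ P *ᵥ y)) • y)
  rw [Matrix.mulVec_add, Matrix.mulVec_smul, hx, smul_zero, add_zero, ← hyd, add_dotProduct,
    smul_dotProduct, smul_eq_mul, div_mul_cancel₀ _ hpos.ne'] at h1
  linarith

lemma pow_ker_of_lyap {n : ℕ} {A P Q : Matrix (Fin n) (Fin n) ℝ} (hP : P.PosDef)
    (hQ : Q.PosSemidef) (h : P * A + Aᵀ * P + Q = 0) (k : ℕ) :
    ∀ x : Fin n → ℝ, (A ^ k) *ᵥ x = 0 → A *ᵥ x = 0 := by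
  induction k with
  | zero => intro x hx; simp at hx; simp [hx]
  | succ k ih =>
    intro x hx
    rw [pow_succ, ← Matrix.mulVec_mulVec] at hx
    exact sq_ker_of_lyap hP hQ h x (ih _ hx)

/-! ### From semi-Hurwitz to the Lyapunov equation -/

lemma exists_group_inverse {n : ℕ} (A : Matrix (Fin n) (Fin n) ℝ)
    (h : ∀ (k : ℕ) (x : Fin n → ℝ), (A ^ k) *ᵥ x = 0 → A *ᵥ x = 0) :
    ∃ G : Matrix (Fin n) (Fin n) ℝ, A * G = G * A ∧ A * G * A = A := by
  have hne : A.charpoly ≠ 0 := (Matrix.charpoly_monic A).ne_zero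
  obtain ⟨q, hq, hq0⟩ := Polynomial.exists_eq_pow_rootMultiplicity_mul_and_not_dvd
    A.charpoly hne 0
  set m := A.charpoly.rootMultiplicity 0
  rw [map_zero, sub_zero] at hq hq0
  have hc0 : q.coeff 0 ≠ 0 := by rwa [Ne, ← Polynomial.X_dvd_iff]
  have hCH := Matrix.aeval_self_charpoly A
  rw [hq, map_mul, map_pow, aeval_X] at hCH
  have hA : A * aeval A q = 0 := by
    apply Matrix.toLin'.injective
    apply LinearMap.ext
    intro x
    rw [Matrix.toLin'_apply, ← Matrix.mulVec_mulVec, map_zero, LinearMap.zero_apply]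
    apply h m
    rw [Matrix.mulVec_mulVec, hCH, Matrix.zero_mulVec]
  have hdiv := Polynomial.X_mul_divX_add q
  set c := q.coeff 0
  have hq2 : aeval A q = A * aeval A q.divX + c • (1 : Matrix (Fin n) (Fin n) ℝ) := by
    conv_lhs => rw [← hdiv]
    rw [map_add, map_mul, aeval_X, aeval_C, Algebra.algebraMap_eq_smul_one]
  have hcomm : A * aeval A q.divX = aeval A q.divX * A := by
    have := congrArg (aeval A) (mul_comm (X : ℝ[X]) q.divX)
    simpa using this
  refine ⟨(-c⁻¹) • aeval A q.divX, ?_, ?_⟩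
  · rw [mul_smul_comm, smul_mul_assoc, hcomm]
  · rw [hq2, mul_add, mul_smul_comm, mul_one] at hA
    rw [mul_smul_comm, smul_mul_assoc, mul_assoc, ← hcomm, eq_neg_of_add_eq_zero_left hA]
    rw [smul_neg, neg_smul, neg_neg, smul_smul, inv_mul_cancel₀ hc0, one_smul]

section gelfand
attribute [local instance] Matrix.frobeniusNormedRing Matrix.frobeniusNormedAlgebra
  Matrix.frobeniusNormedAddCommGroup Matrix.frobeniusNormedSpace

lemma pow_decay_complex {n : ℕ} (C : Matrix (Fin n) (Fin n) ℂ)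
    (hC : ∀ μ : ℂ, C.charpoly.IsRoot μ → ‖μ‖ < 1) :
    ∃ r : ℝ, 0 ≤ r ∧ r < 1 ∧ ∀ᶠ k : ℕ in Filter.atTop, ‖C ^ k‖ ≤ r ^ k := by
  rcases Nat.eq_zero_or_pos n with rfl | hn
  · refine ⟨0, le_rfl, one_pos, Filter.Eventually.of_forall fun k => ?_⟩
    have : C ^ k = 0 := Subsingleton.elim _ _
    rw [this, norm_zero]; positivity
  have : Nonempty (Fin n) := ⟨⟨0, hn⟩⟩
  have : CompleteSpace (Matrix (Fin n) (Fin n) ℂ) := FiniteDimensional.complete ℂ _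
  have hs : spectralRadius ℂ C < (1 : NNReal) := by
    apply spectrum.spectralRadius_lt_of_forall_lt
    intro z hz
    rw [Matrix.mem_spectrum_iff_isRoot_charpoly] at hz
    have := hC z hz
    exact_mod_cast this
  obtain ⟨r, hr1, hr2⟩ := ENNReal.lt_iff_exists_nnreal_btwn.1 hs
  refine ⟨r, r.2, by exact_mod_cast hr2, ?_⟩
  have ht := spectrum.pow_nnnorm_pow_one_div_tendsto_nhds_spectralRadius C
  filter_upwards [ht.eventually (gt_mem_nhds hr1), Filter.eventually_gt_atTop 0] with k hk hk0
  have hk' : ‖C ^ k‖₊ ^ (1 / (k : ℝ)) ≤ r := by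
    have h3 := hk.le
    rw [← ENNReal.coe_rpow_of_nonneg _ (by positivity)] at h3
    exact ENNReal.coe_le_coe.1 h3
  have h2 : ‖C ^ k‖₊ ≤ r ^ k := by
    have h4 := pow_le_pow_left₀ zero_le hk' k
    rwa [one_div, NNReal.rpow_inv_natCast_pow _ hk0.ne'] at h4
  exact_mod_cast h2

lemma summable_gram {n : ℕ} (C A : Matrix (Fin n) (Fin n) ℝ)
    (hC : ∀ μ : ℂ, (charpolyC C).IsRoot μ → ‖μ‖ < 1) :
    Summable fun k : ℕ => (C ^ k * A)ᵀ * (C ^ k * A) := by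
  rw [charpolyC_eq] at hC
  obtain ⟨r, hr0, hr1, hr⟩ := pow_decay_complex _ hC
  refine Summable.of_norm_bounded_eventually_nat
    (g := fun k => r ^ k * ‖A‖ ^ 2) ((summable_geometric_of_lt_one hr0 hr1).mul_right _) ?_
  filter_upwards [hr] with k hk
  have hk2 : ‖C ^ k‖ ≤ r ^ k := by
    rw [← Matrix.map_pow, Matrix.frobenius_norm_map_eq _ _ (fun a => by simp)] at hk
    exact hk
  have hrk : r ^ k ≤ 1 := pow_le_one₀ hr0 hr1.le
  have hrk0 : 0 ≤ r ^ k := by positivity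
  have h1 : ‖C ^ k * A‖ ≤ r ^ k * ‖A‖ :=
    (norm_mul_le _ _).trans (mul_le_mul_of_nonneg_right hk2 (norm_nonneg _))
  calc ‖(C ^ k * A)ᵀ * (C ^ k * A)‖ ≤ ‖(C ^ k * A)ᵀ‖ * ‖C ^ k * A‖ := norm_mul_le _ _
    _ = ‖C ^ k * A‖ * ‖C ^ k * A‖ := by rw [Matrix.frobenius_norm_transpose]
    _ ≤ (r ^ k * ‖A‖) * (r ^ k * ‖A‖) := by gcongr
    _ = (r ^ k * ‖A‖ ^ 2) * r ^ k := by ring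
    _ ≤ (r ^ k * ‖A‖ ^ 2) * 1 := by gcongr
    _ = r ^ k * ‖A‖ ^ 2 := mul_one _

end gelfand

lemma exists_step {n : ℕ} (A : Matrix (Fin n) (Fin n) ℝ) :
    ∃ h : ℝ, 0 < h ∧ ∀ μ : ℂ, (charpolyC A).IsRoot μ → μ.re < 0 → ‖1 + (h : ℂ) * μ‖ < 1 := by
  have hne : charpolyC A ≠ 0 := by
    rw [charpolyC_eq]; exact (Matrix.charpoly_monic _).ne_zero
  have key : ∀ μ : ℂ, μ.re < 0 → ∀ᶠ h : ℝ in nhdsWithin 0 (Set.Ioi 0),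
      ‖1 + (h : ℂ) * μ‖ < 1 := by
    intro μ hμ
    have hμ0 : 0 < Complex.normSq μ := by
      rw [Complex.normSq_pos]; rintro rfl; simp at hμ
    have hd : 0 < -(2 * μ.re) / Complex.normSq μ := div_pos (by linarith) hμ0
    filter_upwards [Ioo_mem_nhdsGT hd] with h hh
    obtain ⟨h0, h1⟩ := hh
    rw [lt_div_iff₀ hμ0] at h1
    have hsq : ‖1 + (h : ℂ) * μ‖ ^ 2 < 1 := by
      rw [← Complex.normSq_eq_norm_sq]
      rw [Complex.normSq_apply] at h1 ⊢
      simp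
      nlinarith
    exact (sq_lt_one_iff₀ (norm_nonneg _)).1 hsq
  have hfin : ∀ᶠ h : ℝ in nhdsWithin 0 (Set.Ioi 0), ∀ μ ∈ (charpolyC A).roots.toFinset,
      μ.re < 0 → ‖1 + (h : ℂ) * μ‖ < 1 := by
    rw [Filter.eventually_all_finset]
    intro μ _
    by_cases hμ : μ.re < 0
    · filter_upwards [key μ hμ] with h hh _ using hh
    · exact Filter.Eventually.of_forall fun h hh => absurd hh hμ
  obtain ⟨h, hh, h0⟩ := (hfin.and self_mem_nhdsWithin).exists
  refine ⟨h, h0, fun μ hμ => hh μ ?_⟩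
  simpa [hne] using hμ

lemma root_C {n : ℕ} (A G : Matrix (Fin n) (Fin n) ℝ) (hc : A * G = G * A)
    (hG : A * G * A = A) (h : ℝ) (hpos : 0 < h)
    (hA : ∀ μ : ℂ, (charpolyC A).IsRoot μ → μ ≠ 0 → ‖1 + (h : ℂ) * μ‖ < 1)
    (μ : ℂ) (hμ : (charpolyC (h • A + A * G)).IsRoot μ) : ‖μ‖ < 1 := by
  -- here `1 + h A - E = h A + A G`, with `E = 1 - A G`
  rw [charpolyC_eq, isRoot_charpoly_iff] at hμ
  obtain ⟨v, hv0, hv⟩ := hμ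
  set A' := A.map (algebraMap ℝ ℂ) with hA'
  set G' := G.map (algebraMap ℝ ℂ) with hG'
  have hc' : A' * G' = G' * A' := by
    rw [hA', hG', ← Matrix.map_mul, hc, Matrix.map_mul]
  have hGG : A' * G' * A' = A' := by
    rw [hA', hG', ← Matrix.map_mul, ← Matrix.map_mul, hG]
  have hM : (h • A + A * G).map (algebraMap ℝ ℂ) = (h : ℂ) • A' + A' * G' := by
    rw [hA', hG', ← Matrix.map_mul]
    ext i j
    simp
  rw [hM] at hv
  by_cases hμ0 : μ = 0
  · simp [hμ0]
  have hFv : (A' * G') *ᵥ v = v := by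
    have h1 : (A' * G') * ((h : ℂ) • A' + A' * G') = (h : ℂ) • A' + A' * G' := by
      rw [mul_add, mul_smul_comm, hGG, ← mul_assoc, hGG]
    have h2 := congrArg (fun w => (A' * G') *ᵥ w) hv
    simp only [Matrix.mulVec_mulVec, h1, Matrix.mulVec_smul] at h2
    rw [hv] at h2
    exact (smul_right_injective _ hμ0 h2).symm
  have hh : (h : ℂ) ≠ 0 := by exact_mod_cast hpos.ne'
  have hAv : A' *ᵥ v = ((μ - 1) / h) • v := by
    rw [Matrix.add_mulVec, Matrix.smul_mulVec, hFv] at hv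
    have : (h : ℂ) • A' *ᵥ v = (μ - 1) • v := by
      rw [sub_smul, one_smul, ← hv, add_sub_cancel_right]
    rw [div_eq_inv_mul, mul_smul, ← this, smul_smul, inv_mul_cancel₀ hh, one_smul]
  have hne : (μ - 1) / (h : ℂ) ≠ 0 := by
    intro h0
    rw [h0, zero_smul] at hAv
    apply hv0
    rw [← hFv, hc', ← Matrix.mulVec_mulVec, hAv, Matrix.mulVec_zero]
  have := hA ((μ - 1) / h) (by
    rw [charpolyC_eq, isRoot_charpoly_iff]; exact ⟨v, hv0, hAv⟩) hne
  rwa [mul_div_cancel₀ _ hh, add_sub_cancel] at this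

lemma gram_quad {n : ℕ} (M : Matrix (Fin n) (Fin n) ℝ) (x : Fin n → ℝ) :
    x ⬝ᵥ (Mᵀ * M) *ᵥ x = (M *ᵥ x) ⬝ᵥ (M *ᵥ x) := by
  rw [← Matrix.mulVec_mulVec, Matrix.dotProduct_mulVec, Matrix.vecMul_transpose]

lemma exists_lyap {n : ℕ} (A G : Matrix (Fin n) (Fin n) ℝ) (hc : A * G = G * A)
    (hG : A * G * A = A) (h : ℝ) (hpos : 0 < h)
    (hA : ∀ μ : ℂ, (charpolyC A).IsRoot μ → μ ≠ 0 → ‖1 + (h : ℂ) * μ‖ < 1) :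
    ∃ P Q : Matrix (Fin n) (Fin n) ℝ,
          P.PosDef ∧ Q.PosSemidef ∧ P * A + Aᵀ * P + Q = 0 := by
  set C := h • A + A * G with hCd
  set E := 1 - A * G with hE
  have hsum := summable_gram C A (fun μ hμ => root_C A G hc hG h hpos hA μ hμ)
  set S := ∑' k : ℕ, (C ^ k * A)ᵀ * (C ^ k * A) with hS
  have hEA : E * A = 0 := by rw [hE, sub_mul, one_mul, hG, sub_self]
  have hCA : A * (1 + h • A) = C * A := by
    rw [hCd, mul_add, mul_one, add_mul, hG, mul_smul_comm, smul_mul_assoc, add_comm]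
  have hshift : ∀ k, C ^ k * A * (1 + h • A) = C ^ (k + 1) * A := by
    intro k
    rw [mul_assoc, hCA, pow_succ, mul_assoc]
  have hSB : (1 + h • A)ᵀ * S * (1 + h • A) + Aᵀ * A = S := by
    rw [hS, ← hsum.tsum_mul_left, ← (hsum.mul_left _).tsum_mul_right]
    conv_rhs => rw [hsum.tsum_eq_zero_add]
    rw [add_comm]
    congr 1
    · simp
    · refine tsum_congr fun k => ?_
      rw [← hshift, Matrix.transpose_mul (C ^ k * A)]
      simp only [mul_assoc]
  have hquad : ∀ x : Fin n → ℝ, (A *ᵥ x) ⬝ᵥ (A *ᵥ x) ≤ x ⬝ᵥ S *ᵥ x := by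
    intro x
    let f : Matrix (Fin n) (Fin n) ℝ →+ ℝ :=
      { toFun := fun M => x ⬝ᵥ M *ᵥ x
        map_zero' := by simp
        map_add' := fun M N => by rw [Matrix.add_mulVec, dotProduct_add] }
    have hf : Continuous f := by
      change Continuous fun M : Matrix (Fin n) (Fin n) ℝ => x ⬝ᵥ M *ᵥ x
      fun_prop
    have h1 := hsum.hasSum.map f hf
    have h2 := le_hasSum h1 0 (fun k _ => by
      change 0 ≤ x ⬝ᵥ ((C ^ k * A)ᵀ * (C ^ k * A)) *ᵥ x
      rw [gram_quad]
      simpa using dotProduct_star_self_nonneg ((C ^ k * A) *ᵥ x))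
    have h3 : (f ∘ fun k : ℕ => (C ^ k * A)ᵀ * (C ^ k * A)) 0
        = x ⬝ᵥ ((C ^ 0 * A)ᵀ * (C ^ 0 * A)) *ᵥ x := rfl
    rw [h3, gram_quad, pow_zero, one_mul] at h2
    exact h2
  have hSt : Sᵀ = S := by
    rw [hS, Matrix.transpose_tsum]
    refine tsum_congr fun k => ?_
    rw [Matrix.transpose_mul, Matrix.transpose_transpose]
  set P := Eᵀ * E + S with hPdef
  have hPt : Pᵀ = P := by
    rw [hPdef, Matrix.transpose_add, hSt, Matrix.transpose_mul, Matrix.transpose_transpose]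
  have hPD : P.PosDef := by
    refine Matrix.PosDef.of_dotProduct_mulVec_pos (by
      rw [Matrix.IsHermitian, Matrix.conjTranspose_eq_transpose_of_trivial, hPt]) ?_
    intro x hx
    rw [star_trivial, hPdef, Matrix.add_mulVec, dotProduct_add, gram_quad]
    have h1 := hquad x
    have h2 : 0 ≤ (E *ᵥ x) ⬝ᵥ (E *ᵥ x) := by simpa using dotProduct_star_self_nonneg (E *ᵥ x)
    have h3 : 0 ≤ (A *ᵥ x) ⬝ᵥ (A *ᵥ x) := by simpa using dotProduct_star_self_nonneg (A *ᵥ x)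
    by_contra hcon
    push Not at hcon
    have h4 : E *ᵥ x = 0 := dotProduct_self_eq_zero.1 (by linarith)
    have h5 : A *ᵥ x = 0 := dotProduct_self_eq_zero.1 (by linarith)
    apply hx
    rw [hE, Matrix.sub_mulVec, Matrix.one_mulVec, hc, ← Matrix.mulVec_mulVec, h5,
      Matrix.mulVec_zero, sub_zero] at h4
    exact h4
  have hEB : E * (1 + h • A) = E := by
    rw [mul_add, mul_one, mul_smul_comm, hEA, smul_zero, add_zero]
  have hPB : (1 + h • A)ᵀ * P * (1 + h • A) + Aᵀ * A = P := by
    have h1 : (1 + h • A)ᵀ * (Eᵀ * E) * (1 + h • A) = Eᵀ * E := by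
      have : (1 + h • A)ᵀ * (Eᵀ * E) * (1 + h • A)
          = (E * (1 + h • A))ᵀ * (E * (1 + h • A)) := by
        rw [Matrix.transpose_mul E]; simp only [mul_assoc]
      rw [this, hEB]
    rw [hPdef, mul_add _ (Eᵀ * E) S, add_mul _ _ (1 + h • A), h1, add_assoc, hSB]
  refine ⟨P, h⁻¹ • (Aᵀ * A) + h • (Aᵀ * P * A), hPD, ?_, ?_⟩
  · refine Matrix.PosSemidef.add (Matrix.PosSemidef.smul ?_ (inv_nonneg.2 hpos.le))
      (Matrix.PosSemidef.smul ?_ hpos.le)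
    · simpa using Matrix.posSemidef_conjTranspose_mul_self A
    · simpa using hPD.posSemidef.conjTranspose_mul_mul_same A
  · have h1 : h • (P * A + Aᵀ * P) + (h * h) • (Aᵀ * P * A) + Aᵀ * A = 0 := by
      have h2 : (1 + h • A)ᵀ * P * (1 + h • A) =
          P + (h • (P * A + Aᵀ * P) + (h * h) • (Aᵀ * P * A)) := by
        rw [Matrix.transpose_add, Matrix.transpose_smul, Matrix.transpose_one]
        simp only [add_mul, mul_add, one_mul, mul_one, smul_mul_assoc, mul_smul_comm, smul_add,
          smul_smul]
        abel
      rw [h2, add_assoc] at hPB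
      exact add_eq_left.1 hPB
    have h3 := congrArg (fun M => h⁻¹ • M) h1
    simp only [smul_add, smul_smul, smul_zero, ← mul_assoc, inv_mul_cancel₀ hpos.ne', one_mul,
      one_smul] at h3
    rw [← h3]
    abel

/-- Lyapunov characterization of semi-Hurwitz matrices: `A` is semi-Hurwitz iff there exist
`P ≻ 0` and `Q ⪰ 0` with `P A + Aᵀ P + Q = 0` and `A` has no purely imaginary nonzero
eigenvalue. -/
theorem isSemiHurwitz_iff_lyapunov {n : ℕ} (A : Matrix (Fin n) (Fin n) ℝ) :
    IsSemiHurwitz A ↔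
      ((∃ P Q : Matrix (Fin n) (Fin n) ℝ,
          P.PosDef ∧ Q.PosSemidef ∧ P * A + Aᵀ * P + Q = 0) ∧
        ∀ μ : ℂ, (charpolyC A).IsRoot μ → μ.re = 0 → μ = 0) := by
  constructor
  · intro hA
    refine ⟨?_, ?_⟩
    · have hk : Module.finrank ℝ (LinearMap.ker A.mulVecLin)
          = (charpolyC A).rootMultiplicity 0 := by
        by_cases h0 : (charpolyC A).IsRoot 0
        · rcases hA 0 h0 with h | h
          · simp at h
          · exact h.2
        · have h1 := Polynomial.rootMultiplicity_eq_zero h0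
          have h2 := Submodule.finrank_mono (ker_le_maxGen A)
          rw [finrank_maxGen] at h2
          omega
      rw [finrank_ker_iff] at hk
      obtain ⟨G, hc, hG⟩ := exists_group_inverse A hk
      obtain ⟨h, hpos, hh⟩ := exists_step A
      refine exists_lyap A G hc hG h hpos fun μ hμ hμ0 => hh μ hμ ?_
      rcases hA μ hμ with h | h
      · exact h
      · exact absurd h.1 hμ0
    · intro μ hμ hre
      rcases hA μ hμ with h | h
      · linarith
      · exact h.1
  · rintro ⟨⟨P, Q, hP, hQ, h⟩, him⟩ μ hμ
    rcases (re_nonpos_of_lyap hP hQ h hμ).lt_or_eq with hlt | heq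
    · exact Or.inl hlt
    · exact Or.inr ⟨him μ hμ heq, (finrank_ker_iff A).2 (pow_ker_of_lyap hP hQ h)⟩
end
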